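/- arXiv:math/0307263 — 2 statements merged into one kernel-verified Lean document; each statement's English description precedes it below -/
import Mathlib

section
/- The category of 2-vector spaces (categories internal to Vect with internal functors) is equivalent to the category of 2-term chain complexes of vector spaces (complexes d : C₁ → C₀ with chain maps). The equivalence sends a 2-vector space V to the complex ker(s) → V₀ with differential t restricted to ker(s), and conversely sends a complex d : C₁ → C₀ to the 2-vector space with objects C₀, morphisms C₀ ⊕ C₁, source (x,f̄) ↦ x, target (x,f̄) ↦ x + d(f̄), and identity x ↦ (x,0). -/
open CategoryTheory

/-- A 2-vector space: a category internal to `Vect` over the field `k`. -/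
structure TwoVectSp (k : Type) [Field k] where
  V0 : Type
  V1 : Type
  [ac0 : AddCommGroup V0]
  [mod0 : Module k V0]
  [ac1 : AddCommGroup V1]
  [mod1 : Module k V1]
  s : V1 →ₗ[k] V0
  t : V1 →ₗ[k] V0
  i : V0 →ₗ[k] V1
  s_i : ∀ x, s (i x) = x
  t_i : ∀ x, t (i x) = x
  comp : ∀ f g : V1, t f = s g → V1
  comp_add : ∀ f g f' g' (h : t f = s g) (h' : t f' = s g')
      (h'' : t (f + f') = s (g + g')),
      comp (f + f') (g + g') h'' = comp f g h + comp f' g' h'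
  comp_smul : ∀ (c : k) (f g : V1) (h : t f = s g) (h' : t (c • f) = s (c • g)),
      comp (c • f) (c • g) h' = c • comp f g h
  s_comp : ∀ f g (h : t f = s g), s (comp f g h) = s f
  t_comp : ∀ f g (h : t f = s g), t (comp f g h) = t g
  id_comp : ∀ f (h : t (i (s f)) = s f), comp (i (s f)) f h = f
  comp_id : ∀ f (h : t f = s (i (t f))), comp f (i (t f)) h = f
  assoc : ∀ f g e (hfg : t f = s g) (hge : t g = s e)
      (h1 : t (comp f g hfg) = s e) (h2 : t f = s (comp g e hge)),
      comp (comp f g hfg) e h1 = comp f (comp g e hge) h2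

attribute [instance] TwoVectSp.ac0 TwoVectSp.mod0 TwoVectSp.ac1 TwoVectSp.mod1

variable (k : Type) [Field k]

/-- A linear functor between 2-vector spaces: an internal functor in `Vect`. -/
structure TwoVectHom (V W : TwoVectSp k) where
  F0 : V.V0 →ₗ[k] W.V0
  F1 : V.V1 →ₗ[k] W.V1
  hs : ∀ f, W.s (F1 f) = F0 (V.s f)
  ht : ∀ f, W.t (F1 f) = F0 (V.t f)
  hi : ∀ x, F1 (V.i x) = W.i (F0 x)
  hcomp : ∀ f g (h : V.t f = V.s g) (h' : W.t (F1 f) = W.s (F1 g)),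
    F1 (V.comp f g h) = W.comp (F1 f) (F1 g) h'

theorem TwoVectHom.ext' {V W : TwoVectSp k} {F G : TwoVectHom k V W}
    (h0 : F.F0 = G.F0) (h1 : F.F1 = G.F1) : F = G := by
  cases F; cases G; cases h0; cases h1; rfl

/-- The category `2Vect` of 2-vector spaces and linear functors. -/
instance : Category (TwoVectSp k) where
  Hom V W := TwoVectHom k V W
  id V :=
    { F0 := LinearMap.id, F1 := LinearMap.id,
      hs := fun _ => rfl, ht := fun _ => rfl, hi := fun _ => rfl,
      hcomp := fun _ _ _ _ => rfl }
  comp {U V W} F G :=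
    { F0 := G.F0 ∘ₗ F.F0, F1 := G.F1 ∘ₗ F.F1,
      hs := fun f => by simp [G.hs, F.hs],
      ht := fun f => by simp [G.ht, F.ht],
      hi := fun x => by simp [F.hi, G.hi],
      hcomp := fun f g h h' => by
        have h2 : V.t (F.F1 f) = V.s (F.F1 g) := by rw [F.ht, F.hs, h]
        simp only [LinearMap.comp_apply]
        rw [F.hcomp f g h h2, G.hcomp _ _ h2 h'] }
  id_comp F := TwoVectHom.ext' k (by ext x; rfl) (by ext x; rfl)
  comp_id F := TwoVectHom.ext' k (by ext x; rfl) (by ext x; rfl)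
  assoc F G H := TwoVectHom.ext' k (by ext x; rfl) (by ext x; rfl)

/-- A 2-term chain complex of vector spaces. -/
structure TwoTermCx (k : Type) [Field k] where
  C0 : Type
  C1 : Type
  [ac0 : AddCommGroup C0]
  [mod0 : Module k C0]
  [ac1 : AddCommGroup C1]
  [mod1 : Module k C1]
  d : C1 →ₗ[k] C0

attribute [instance] TwoTermCx.ac0 TwoTermCx.mod0 TwoTermCx.ac1 TwoTermCx.mod1

/-- A chain map between 2-term chain complexes. -/
structure TwoTermHom (C D : TwoTermCx k) where
  f0 : C.C0 →ₗ[k] D.C0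
  f1 : C.C1 →ₗ[k] D.C1
  hd : ∀ h, D.d (f1 h) = f0 (C.d h)

theorem TwoTermHom.ext' {C D : TwoTermCx k} {F G : TwoTermHom k C D}
    (h0 : F.f0 = G.f0) (h1 : F.f1 = G.f1) : F = G := by
  cases F; cases G; cases h0; cases h1; rfl

/-- The category `2Term` of 2-term chain complexes and chain maps. -/
instance : Category (TwoTermCx k) where
  Hom C D := TwoTermHom k C D
  id C := { f0 := LinearMap.id, f1 := LinearMap.id, hd := fun _ => rfl }
  comp F G :=
    { f0 := G.f0 ∘ₗ F.f0, f1 := G.f1 ∘ₗ F.f1,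
      hd := fun h => by simp [G.hd, F.hd] }
  id_comp F := TwoTermHom.ext' k (by ext x; rfl) (by ext x; rfl)
  comp_id F := TwoTermHom.ext' k (by ext x; rfl) (by ext x; rfl)
  assoc F G H := TwoTermHom.ext' k (by ext x; rfl) (by ext x; rfl)

/-- The 2-term chain complex associated to a 2-vector space:
`ker s → V₀` with differential the restriction of `t`. -/
def Sobj (V : TwoVectSp k) : TwoTermCx k where
  C0 := V.V0
  C1 := LinearMap.ker V.s
  d := V.t ∘ₗ (LinearMap.ker V.s).subtype

/-- The 2-vector space associated to a 2-term chain complex `d : C₁ → C₀`: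
objects `C₀`, morphisms `C₀ ⊕ C₁`, source `(x, f̄) ↦ x`, target
`(x, f̄) ↦ x + d f̄`, identities `x ↦ (x, 0)`, composition adding
arrow parts. -/
def Tobj (C : TwoTermCx k) : TwoVectSp k where
  V0 := C.C0
  V1 := C.C0 × C.C1
  s := LinearMap.fst k C.C0 C.C1
  t := LinearMap.fst k C.C0 C.C1 + C.d ∘ₗ LinearMap.snd k C.C0 C.C1
  i := LinearMap.prod LinearMap.id 0
  s_i := fun x => rfl
  t_i := fun x => by simp
  comp := fun f g _ => (f.1, f.2 + g.2)
  comp_add := fun f g f' g' h h' h'' => by ext <;> simp <;> abel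
  comp_smul := fun c f g h h' => by ext <;> simp
  s_comp := fun f g h => rfl
  t_comp := fun f g h => by
    have : f.1 + C.d f.2 = g.1 := h
    simp only [LinearMap.add_apply, LinearMap.fst_apply, LinearMap.comp_apply,
      LinearMap.snd_apply] at *
    rw [map_add, ← add_assoc, this]
  id_comp := fun f h => by ext <;> simp
  comp_id := fun f h => by ext <;> simp
  assoc := fun f g e hfg hge h1 h2 => by ext <;> simp <;> abel

/-- Composition in a 2-vector space is determined by its underlying reflexive graph. -/
theorem TwoVectSp.comp_eq {k : Type} [Field k] (V : TwoVectSp k) (f g : V.V1)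
    (h : V.t f = V.s g) : V.comp f g h = f + (g - V.i (V.t f)) := by
  have hs : V.s (g - V.i (V.t f)) = 0 := by simp [V.s_i, h]
  have h₁ : V.t f = V.s (V.i (V.t f)) := (V.s_i _).symm
  have h₂ : V.t 0 = V.s (g - V.i (V.t f)) := by simp [hs]
  have left_unit : V.comp 0 (g - V.i (V.t f)) h₂ = g - V.i (V.t f) := by
    have hu := V.id_comp (g - V.i (V.t f)) (V.t_i _)
    simpa only [hs, map_zero] using hu
  have hadd := V.comp_add f (V.i (V.t f)) 0 (g - V.i (V.t f)) h₁ h₂ (by simpa using h)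
  rw [V.comp_id, left_unit] at hadd
  simpa only [add_zero, add_sub_cancel] using hadd

/-- A map of reflexive graphs in `Vect` between 2-vector spaces is a linear functor. -/
def TwoVectHom.ofGraphMap {k : Type} [Field k] {V W : TwoVectSp k}
    (F0 : V.V0 →ₗ[k] W.V0) (F1 : V.V1 →ₗ[k] W.V1)
    (hs : ∀ f, W.s (F1 f) = F0 (V.s f)) (ht : ∀ f, W.t (F1 f) = F0 (V.t f))
    (hi : ∀ x, F1 (V.i x) = W.i (F0 x)) : TwoVectHom k V W where
  F0 := F0
  F1 := F1
  hs := hs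
  ht := ht
  hi := hi
  hcomp f g h h' := by simp only [TwoVectSp.comp_eq, map_add, map_sub, hi, ht]

/-- The chain map induced by a linear functor. -/
def Smap {V W : TwoVectSp k} (F : TwoVectHom k V W) :
    TwoTermHom k (Sobj k V) (Sobj k W) where
  f0 := F.F0
  f1 := F.F1.restrict fun f hf => by
    rw [LinearMap.mem_ker] at hf ⊢
    rw [F.hs, hf, map_zero]
  hd f := F.ht f.1

/-- The functor from 2-vector spaces to 2-term chain complexes. -/
def Sfunctor : TwoVectSp k ⥤ TwoTermCx k where
  obj := Sobj k
  map F := Smap k F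
  map_id _ := rfl
  map_comp _ _ := rfl

/-- The linear functor induced by a chain map. -/
def Tmap {C D : TwoTermCx k} (φ : TwoTermHom k C D) :
    TwoVectHom k (Tobj k C) (Tobj k D) :=
  .ofGraphMap φ.f0 (φ.f0.prodMap φ.f1) (fun _ => rfl)
    (fun f => show φ.f0 f.1 + D.d (φ.f1 f.2) = φ.f0 (f.1 + C.d f.2) by rw [φ.hd, map_add])
    (fun x => show (φ.f0 x, φ.f1 0) = (φ.f0 x, 0) by rw [map_zero])

/-- The functor from 2-term chain complexes to 2-vector spaces. -/
def Tfunctor : TwoTermCx k ⥤ TwoVectSp k where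
  obj := Tobj k
  map φ := Tmap k φ
  map_id _ := rfl
  map_comp _ _ := rfl

/-- The arrow part `f - i (s f)` of a morphism `f` of a 2-vector space. -/
def TwoVectSp.arrowPart {k : Type} [Field k] (V : TwoVectSp k) :
    V.V1 →ₗ[k] LinearMap.ker V.s :=
  (LinearMap.id - V.i ∘ₗ V.s).codRestrict _ fun f => by simp [V.s_i]

theorem TwoVectSp.s_i_add {k : Type} [Field k] (V : TwoVectSp k) (x : V.V0)
    (f : LinearMap.ker V.s) : V.s (V.i x + f) = x := by
  rw [map_add, V.s_i, LinearMap.mem_ker.mp f.2, add_zero]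

theorem TwoVectSp.t_i_add {k : Type} [Field k] (V : TwoVectSp k) (x : V.V0) (f : V.V1) :
    V.t (V.i x + f) = x + V.t f := by
  rw [map_add, V.t_i]

theorem TwoVectSp.arrowPart_i_add {k : Type} [Field k] (V : TwoVectSp k) (x : V.V0)
    (f : LinearMap.ker V.s) : V.arrowPart (V.i x + f) = f := by
  ext
  change V.i x + f.1 - V.i (V.s (V.i x + f.1)) = f.1
  rw [V.s_i_add, add_sub_cancel_left]

theorem TwoVectHom.arrowPart_F1 {k : Type} [Field k] {V W : TwoVectSp k}
    (F : TwoVectHom k V W) (f : V.V1) :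
    (W.arrowPart (F.F1 f) : W.V1) = F.F1 (V.arrowPart f) := by
  change F.F1 f - W.i (W.s (F.F1 f)) = F.F1 (f - V.i (V.s f))
  rw [map_sub, F.hi, F.hs]

/-- A 2-vector space is isomorphic to the one built from its 2-term complex. -/
def unitIsoApp (V : TwoVectSp k) : V ≅ Tobj k (Sobj k V) where
  hom := TwoVectHom.ofGraphMap (W := Tobj k (Sobj k V)) LinearMap.id (V.s.prod V.arrowPart)
    (fun _ => rfl)
    (fun f => show V.s f + V.t (f - V.i (V.s f)) = V.t f by
      rw [map_sub, V.t_i, add_sub_cancel])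
    (fun x => Prod.ext (V.s_i x) <| Subtype.ext <|
      show V.i x - V.i (V.s (V.i x)) = 0 by rw [V.s_i, sub_self])
  inv := TwoVectHom.ofGraphMap (V := Tobj k (Sobj k V)) LinearMap.id
    (V.i.coprod (LinearMap.ker V.s).subtype)
    (fun f => V.s_i_add f.1 f.2)
    (fun f => V.t_i_add f.1 f.2.1)
    (fun x => show V.i x + 0 = V.i x from add_zero _)
  hom_inv_id := TwoVectHom.ext' k rfl <| LinearMap.ext fun f =>
    show V.i (V.s f) + (f - V.i (V.s f)) = f from add_sub_cancel _ _
  inv_hom_id := TwoVectHom.ext' k rfl <| LinearMap.ext fun f =>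
    Prod.ext (V.s_i_add f.1 f.2) (V.arrowPart_i_add f.1 f.2)

/-- A 2-term complex is isomorphic to the one extracted from its 2-vector space. -/
def counitIsoApp (C : TwoTermCx k) : Sobj k (Tobj k C) ≅ C where
  hom :=
    { f0 := LinearMap.id
      f1 := LinearMap.snd k C.C0 C.C1 ∘ₗ (LinearMap.ker (Tobj k C).s).subtype
      hd := fun f => by
        have hf : f.1.1 = 0 := f.2
        change C.d f.1.2 = f.1.1 + C.d f.1.2
        rw [hf, zero_add] }
  inv :=
    { f0 := LinearMap.id
      f1 := (LinearMap.inr k C.C0 C.C1).codRestrict (LinearMap.ker (Tobj k C).s) fun _ => rfl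
      hd := fun c => show 0 + C.d c = C.d c from zero_add _ }
  hom_inv_id := TwoTermHom.ext' k rfl <| LinearMap.ext fun f =>
    Subtype.ext (Prod.ext (Eq.symm f.2) rfl)
  inv_hom_id := rfl

/-- The equivalence between 2-vector spaces and 2-term chain complexes. -/
def twoVectEquivTwoTerm : TwoVectSp k ≌ TwoTermCx k :=
  .mk (Sfunctor k) (Tfunctor k)
    (NatIso.ofComponents (unitIsoApp k) fun F =>
      TwoVectHom.ext' k rfl <| LinearMap.ext fun f =>
        Prod.ext (TwoVectHom.hs F f) (Subtype.ext (TwoVectHom.arrowPart_F1 F f)))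
    (NatIso.ofComponents (counitIsoApp k) fun _ => rfl)

/-- The categories `2Vect` and `2Term` are equivalent, via the equivalence
sending a 2-vector space `V` to the complex `t|_{ker s} : ker s → V₀`, and a
complex `d : C₁ → C₀` to the 2-vector space with objects `C₀` and morphisms
`C₀ ⊕ C₁`. -/
theorem twoVect_equiv_twoTerm :
    ∃ e : TwoVectSp k ≌ TwoTermCx k,
      (∀ V : TwoVectSp k, e.functor.obj V = Sobj k V) ∧
      (∀ C : TwoTermCx k, e.inverse.obj C = Tobj k C) := by
  exact ⟨twoVectEquivTwoTerm k, fun _ => rfl, fun _ => rfl⟩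
end

section
/- A 2-term L∞-algebra with vanishing l₃ (i.e., a 2-term chain complex d : V₁ → V₀ with a bracket satisfying the Jacobi identity strictly, d[x,h] = [x,dh], and [dh,k] = [h,dk]) determines a differential crossed module: 𝔤 = V₀ with bracket l₂ is a Lie algebra, 𝔥 = V₁ with bracket [h,k] := [dh,k] is a Lie algebra, d : 𝔥 → 𝔤 is a Lie algebra homomorphism, and α(x)(h) := [x,h] defines an action of 𝔤 by derivations of 𝔥 satisfying d(α(x)(h)) = [x, d h] and α(d h)(h') = [h,h']. -/
/-- A 2-term L∞-algebra, presented via its concrete data (Lemma 4.3.3 of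
Baez–Crans): vector spaces `V0`, `V1`, a differential `d : V1 → V0`, a bracket
`l2` (with mixed-degree component `l2'`, where `l2' x h = [x, h]` and
`[h, x] = - l2' x h`; the bracket of two 1-chains vanishes), and a totally
antisymmetric trilinear map `l3`, satisfying the identities coming from the
generalized Jacobi identities of an L∞-algebra. -/
structure TwoTermLinfty (k : Type) [Field k] (V0 V1 : Type)
    [AddCommGroup V0] [Module k V0] [AddCommGroup V1] [Module k V1] where
  d : V1 →ₗ[k] V0
  l2 : V0 →ₗ[k] V0 →ₗ[k] V0
  l2' : V0 →ₗ[k] V1 →ₗ[k] V1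
  l3 : V0 →ₗ[k] V0 →ₗ[k] V0 →ₗ[k] V1
  skew : ∀ x y, l2 x y = - l2 y x
  l3_antisymm_swap12 : ∀ x y z, l3 x y z = - l3 y x z
  l3_antisymm_swap23 : ∀ x y z, l3 x y z = - l3 x z y
  ax_e : ∀ x h, d (l2' x h) = l2 x (d h)
  ax_f : ∀ h k, l2' (d h) k = - l2' (d k) h
  ax_g : ∀ x y z, d (l3 x y z) = - l2 (l2 x y) z + l2 (l2 x z) y + l2 x (l2 y z)
  ax_h : ∀ h x y, l3 (d h) x y =
    - l2' (l2 x y) h - l2' y (l2' x h) + l2' x (l2' y h)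
  ax_i : ∀ w x y z,
    - l2' z (l3 w x y) - l2' x (l3 w y z)
      + l3 (l2 w y) x z + l3 (l2 x z) w y =
    - l2' y (l3 w x z) - l2' w (l3 x y z)
      + l3 (l2 w x) y z + l3 (l2 w z) x y
      + l3 (l2 x y) w z + l3 (l2 y z) w x

/-- With vanishing `l₃`, the bracket on `V0` satisfies the Jacobi identity. -/
theorem TwoTermLinfty.l2_jacobi {k V0 V1 : Type} [Field k]
    [AddCommGroup V0] [Module k V0] [AddCommGroup V1] [Module k V1]
    (V : TwoTermLinfty k V0 V1) (hl3 : V.l3 = 0) (x y z : V0) :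
    V.l2 (V.l2 x y) z = V.l2 (V.l2 x z) y + V.l2 x (V.l2 y z) := by
  have h := V.ax_g x y z
  simp only [hl3, LinearMap.zero_apply, map_zero] at h
  rw [← sub_eq_zero, ← neg_eq_zero, h]
  abel

/-- With vanishing `l₃`, the mixed bracket is an action of `V0` on `V1`. -/
theorem TwoTermLinfty.l2'_l2 {k V0 V1 : Type} [Field k]
    [AddCommGroup V0] [Module k V0] [AddCommGroup V1] [Module k V1]
    (V : TwoTermLinfty k V0 V1) (hl3 : V.l3 = 0) (x y : V0) (h : V1) :
    V.l2' (V.l2 x y) h = V.l2' x (V.l2' y h) - V.l2' y (V.l2' x h) := by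
  have e := V.ax_h h x y
  simp only [hl3, LinearMap.zero_apply] at e
  rw [← sub_eq_zero, ← neg_eq_zero, e]
  abel

/-- A 2-term L∞-algebra with vanishing `l₃` (a strict Lie 2-algebra)
determines a differential crossed module: `𝔤 = V0` with `l2` is a Lie
algebra; `𝔥 = V1` with `[h, k] := l2'(dh, k)` is a Lie algebra; `d` is a Lie
algebra homomorphism; and `α(x)(h) := l2'(x, h)` is an action of `𝔤` by
derivations of `𝔥` which is a Lie algebra homomorphism and satisfies
`d (α(x)(h)) = [x, dh]` and `α(dh)(h') = [h, h']`. -/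
theorem strict_gives_differential_crossed_module
    (k : Type) [Field k] (V0 V1 : Type)
    [AddCommGroup V0] [Module k V0] [AddCommGroup V1] [Module k V1]
    (V : TwoTermLinfty k V0 V1) (hl3 : V.l3 = 0) :
    let br1 : V1 → V1 → V1 := fun h h' => V.l2' (V.d h) h'  -- bracket on 𝔥
    let α : V0 → V1 → V1 := fun x h => V.l2' x h            -- the action
    -- 𝔤 = V0 is a Lie algebra (bracket already skew): Jacobi holds strictly
    (∀ x y z : V0, V.l2 (V.l2 x y) z = V.l2 (V.l2 x z) y + V.l2 x (V.l2 y z)) ∧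
    -- 𝔥 = V1 is a Lie algebra with bracket br1
    (∀ h h' : V1, br1 h h' = - br1 h' h) ∧
    (∀ g h h' : V1, br1 (br1 g h) h' = br1 (br1 g h') h + br1 g (br1 h h')) ∧
    -- d is a Lie algebra homomorphism
    (∀ h h' : V1, V.d (br1 h h') = V.l2 (V.d h) (V.d h')) ∧
    -- α(x) is a derivation of 𝔥 for each x
    (∀ (x : V0) (h h' : V1), α x (br1 h h') = br1 (α x h) h' + br1 h (α x h')) ∧
    -- α is a Lie algebra homomorphism 𝔤 → der(𝔥)
    (∀ (x y : V0) (h : V1),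
      α (V.l2 x y) h = α x (α y h) - α y (α x h)) ∧
    -- the crossed module conditions
    (∀ (x : V0) (h : V1), V.d (α x h) = V.l2 x (V.d h)) ∧
    (∀ h h' : V1, α (V.d h) h' = br1 h h') := by
  refine ⟨V.l2_jacobi hl3, V.ax_f, fun g h h' => ?_, fun h h' => V.ax_e _ _,
    fun x h h' => ?_, V.l2'_l2 hl3, V.ax_e, fun _ _ => rfl⟩
  · beta_reduce
    rw [V.ax_e, V.l2'_l2 hl3, V.ax_f (V.l2' (V.d g) h') h]
    abel
  · beta_reduce
    rw [V.ax_e, V.l2'_l2 hl3]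
    abel
end
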